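/- Large-variance lower bound on the denoising residual (Proposition 4.1, part 2): For any parameter θ of the ReLU network, any data point x_i and noise vector ξ_{ij}, and any ε₂ > 0, there exists M > 0 such that whenever σ̄_{t_j} > M, one has ‖σ̄_{t_j} S(θ; t_j, x_i + σ̄_{t_j} ξ_{ij}) + ξ_{ij}‖ ≥ M² (‖S(θ; t_j, ξ_{ij})‖ − ε₂). (The proof relies on the positive homogeneity S(θ; t, cX) = c·S(θ; t, X) for c ≥ 0 of bias-free ReLU networks and on their local Lipschitzness.) -/

import Mathlib

/-!
Large-variance lower bound on the denoising residual (Proposition 4.1, part 2):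
for any parameters `θ` of the bias-free deep ReLU network, any data point `x`,
noise vector `ξ`, and any `ε₂ > 0`, there exists `M > 0` such that whenever `σ̄ > M`,
`‖σ̄ S(θ; x + σ̄ ξ) + ξ‖ ≥ M² (‖S(θ; ξ)‖ − ε₂)`.
(The proof uses positive homogeneity and local Lipschitzness of bias-free ReLU networks.)
-/


noncomputable section
open Finset

/-- Entrywise ReLU. -/
def relu {k : ℕ} (v : Fin k → ℝ) : Fin k → ℝ := fun i => max (v i) 0

/-- Matrix–vector product. -/
def mv {a b : ℕ} (W : Fin a → Fin b → ℝ) (v : Fin b → ℝ) : Fin a → ℝ :=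
  fun i => ∑ j, W i j * v j

/-- Euclidean (ℓ²) norm. -/
def vnorm {k : ℕ} (v : Fin k → ℝ) : ℝ := Real.sqrt (∑ i, v i ^ 2)

/-- Hidden activations of the bias-free deep ReLU network:
`q₀ = σ(W₀ X)`, `q_ℓ = σ(W_ℓ q_{ℓ−1})` (hidden weights are indexed `1, …, L`). -/
def act {m d : ℕ} (W0 : Fin m → Fin d → ℝ) (Wh : ℕ → Fin m → Fin m → ℝ)
    (X : Fin d → ℝ) : ℕ → Fin m → ℝ
  | 0 => relu (mv W0 X)
  | ℓ + 1 => relu (mv (Wh (ℓ + 1)) (act W0 Wh X ℓ))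

/-- Output of the bias-free deep ReLU network
`S(θ; X) = W_{L+1} σ(W_L ⋯ W_1 σ(W_0 X))`. -/
def netOut {m d : ℕ} (L : ℕ) (W0 : Fin m → Fin d → ℝ) (Wh : ℕ → Fin m → Fin m → ℝ)
    (WL1 : Fin d → Fin m → ℝ) (X : Fin d → ℝ) : Fin d → ℝ :=
  mv WL1 (act W0 Wh X L)


open Filter Topology

theorem vnorm_nonneg {k : ℕ} (v : Fin k → ℝ) : 0 ≤ vnorm v := Real.sqrt_nonneg _

theorem vnorm_smul {k : ℕ} {c : ℝ} (hc : 0 ≤ c) (v : Fin k → ℝ) :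
    vnorm (c • v) = c * vnorm v := by
  simp only [vnorm, Pi.smul_apply, smul_eq_mul, mul_pow, ← Finset.mul_sum]
  rw [Real.sqrt_mul (sq_nonneg c), Real.sqrt_sq hc]

theorem continuous_vnorm {k : ℕ} : Continuous (vnorm : (Fin k → ℝ) → ℝ) := by
  unfold vnorm
  fun_prop

theorem relu_smul {k : ℕ} {c : ℝ} (hc : 0 ≤ c) (v : Fin k → ℝ) :
    relu (c • v) = c • relu v := by
  ext i
  simp [relu, mul_max_of_nonneg _ _ hc]

theorem continuous_relu {k : ℕ} : Continuous (relu : (Fin k → ℝ) → Fin k → ℝ) := by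
  unfold relu
  fun_prop

theorem mv_smul {a b : ℕ} (W : Fin a → Fin b → ℝ) (c : ℝ) (v : Fin b → ℝ) :
    mv W (c • v) = c • mv W v := by
  ext i
  simp only [mv, Pi.smul_apply, smul_eq_mul, Finset.mul_sum]
  exact Finset.sum_congr rfl fun j _ => mul_left_comm _ _ _

theorem continuous_mv {a b : ℕ} (W : Fin a → Fin b → ℝ) : Continuous (mv W) := by
  unfold mv
  fun_prop

section Network

variable {m d : ℕ} (W0 : Fin m → Fin d → ℝ) (Wh : ℕ → Fin m → Fin m → ℝ)

theorem act_smul {c : ℝ} (hc : 0 ≤ c) (X : Fin d → ℝ) (l : ℕ) :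
    act W0 Wh (c • X) l = c • act W0 Wh X l := by
  induction l with
  | zero => simp only [act, mv_smul, relu_smul hc]
  | succ l ih => simp only [act, ih, mv_smul, relu_smul hc]

theorem continuous_act (l : ℕ) : Continuous fun X => act W0 Wh X l := by
  induction l with
  | zero => exact continuous_relu.comp (continuous_mv W0)
  | succ l ih => exact continuous_relu.comp ((continuous_mv _).comp ih)

variable (L : ℕ) (WL1 : Fin d → Fin m → ℝ)

/-- A bias-free ReLU network is positively homogeneous. -/
theorem netOut_smul {c : ℝ} (hc : 0 ≤ c) (X : Fin d → ℝ) :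
    netOut L W0 Wh WL1 (c • X) = c • netOut L W0 Wh WL1 X := by
  simp only [netOut, act_smul W0 Wh hc, mv_smul]

theorem continuous_netOut : Continuous (netOut L W0 Wh WL1) :=
  (continuous_mv WL1).comp (continuous_act W0 Wh L)

/-- By homogeneity, the residual at noise level `s` is `s²` times a continuous function of `s⁻¹`. -/
theorem residual_eq_smul (x ξ : Fin d → ℝ) {s : ℝ} (hs : 0 < s) :
    (fun r => s * netOut L W0 Wh WL1 (fun r' => x r' + s * ξ r') r + ξ r) =
      s ^ 2 • (netOut L W0 Wh WL1 (s⁻¹ • x + ξ) + (s⁻¹) ^ 2 • ξ) := by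
  have hX : (fun r' => x r' + s * ξ r') = s • (s⁻¹ • x + ξ) := by
    ext r
    simp only [Pi.smul_apply, Pi.add_apply, smul_eq_mul]
    field_simp
  ext r
  rw [hX, netOut_smul W0 Wh L WL1 hs.le]
  simp only [Pi.smul_apply, Pi.add_apply, smul_eq_mul]
  field_simp

/-- The residual divided by `s²` tends in norm to the network output at the noise vector. -/
theorem tendsto_vnorm_rescaled_residual (x ξ : Fin d → ℝ) :
    Tendsto (fun s : ℝ => vnorm (netOut L W0 Wh WL1 (s⁻¹ • x + ξ) + (s⁻¹) ^ 2 • ξ)) atTop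
      (𝓝 (vnorm (netOut L W0 Wh WL1 ξ))) := by
  have hnet := continuous_netOut W0 Wh L WL1
  have hcont : Continuous fun t : ℝ => vnorm (netOut L W0 Wh WL1 (t • x + ξ) + t ^ 2 • ξ) :=
    continuous_vnorm.comp (by fun_prop)
  simpa [Function.comp_def] using (hcont.tendsto 0).comp tendsto_inv_atTop_zero

end Network

theorem large_variance_residual_lower_bound
    (m d L : ℕ)
    (W0 : Fin m → Fin d → ℝ) (Wh : ℕ → Fin m → Fin m → ℝ) (WL1 : Fin d → Fin m → ℝ)
    (x ξ : Fin d → ℝ) (ε₂ : ℝ) (hε₂ : 0 < ε₂) :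
    ∃ M : ℝ, 0 < M ∧
      ∀ sb : ℝ, M < sb →
        M ^ 2 * (vnorm (netOut L W0 Wh WL1 ξ) - ε₂) ≤
          vnorm (fun r =>
            sb * netOut L W0 Wh WL1 (fun r' => x r' + sb * ξ r') r + ξ r) := by
  obtain ⟨N, hN⟩ := eventually_atTop.1
    ((tendsto_vnorm_rescaled_residual W0 Wh L WL1 x ξ).eventually_const_le
      (sub_lt_self _ hε₂))
  refine ⟨max N 1, by positivity, fun s hs => ?_⟩
  have hs0 : 0 < s := lt_trans (by positivity) hs
  rw [residual_eq_smul W0 Wh L WL1 x ξ hs0, vnorm_smul (sq_nonneg s)]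
  calc (max N 1) ^ 2 * (vnorm (netOut L W0 Wh WL1 ξ) - ε₂)
      ≤ (max N 1) ^ 2 * vnorm (netOut L W0 Wh WL1 (s⁻¹ • x + ξ) + (s⁻¹) ^ 2 • ξ) := by
        gcongr
        exact hN s ((le_max_left N 1).trans hs.le)
    _ ≤ _ := by
        have := vnorm_nonneg (netOut L W0 Wh WL1 (s⁻¹ • x + ξ) + (s⁻¹) ^ 2 • ξ)
        gcongr

end
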